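/- arXiv:1512.08218 — 6 statements merged into one kernel-verified Lean document; each statement's English description precedes it below -/
import Mathlib

section
/- Let n ≥ 2 and let c ∈ ℝ with c ≠ 0. Suppose h : Fin n → Fin n → Fin n → ℝ is a totally symmetric 3-tensor satisfying the flat Ricci commutator relation with constant c, with slice matrices H m. Then every real symmetric n×n matrix A that commutes with every slice H m (i.e., A * H m = H m * A for all m) is a scalar multiple of the identity matrix. -/
open Matrix BigOperators

/-- If `h` is a totally symmetric 3-tensor satisfying the flat Ricci
commutator relation with constant `c ≠ 0` (with `n ≥ 2`), then every real symmetric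
matrix commuting with all slices `H m` is a scalar multiple of the identity. -/
theorem commuting_symmetric_is_scalar
    (n : ℕ) (hn : 2 ≤ n) (c : ℝ) (hc : c ≠ 0)
    (h : Fin n → Fin n → Fin n → ℝ)
    (hsymm12 : ∀ i j k : Fin n, h i j k = h j i k)
    (hsymm23 : ∀ i j k : Fin n, h i j k = h i k j)
    (H : Fin n → Matrix (Fin n) (Fin n) ℝ)
    (hH : ∀ m j k : Fin n, H m j k = h m j k)
    (hRicci : ∀ i j k l : Fin n,
      (H i * H j - H j * H i) k l
        = (c / 4) * ((if i = l then (1:ℝ) else 0) * (if j = k then (1:ℝ) else 0)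
            - (if i = k then (1:ℝ) else 0) * (if j = l then (1:ℝ) else 0)))
    (A : Matrix (Fin n) (Fin n) ℝ)
    (hAsymm : A.IsSymm)
    (hAcomm : ∀ m : Fin n, A * H m = H m * A) :
    ∃ r : ℝ, A = r • (1 : Matrix (Fin n) (Fin n) ℝ) := by
  have hcomm (i j : Fin n) : A * (H i * H j - H j * H i) = (H i * H j - H j * H i) * A := by
    have h₁ (i j : Fin n) : Commute A (H i * H j) :=
      Commute.mul_right (hAcomm i) (hAcomm j)
    exact Commute.sub_right (h₁ i j) (h₁ j i)
  have hentry (i j p q : Fin n) :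
      A p j * (if i = q then 1 else 0) - A p i * (if j = q then 1 else 0)
        = (if j = p then 1 else 0) * A i q - (if i = p then 1 else 0) * A j q := by
    have hpq := congrFun (congrFun (hcomm i j) p) q
    simp only [Matrix.mul_apply (M := A), Matrix.mul_apply (N := A), hRicci] at hpq
    have hl : ∑ x, A p x * (c / 4 * ((if i = q then (1:ℝ) else 0) * (if j = x then (1:ℝ) else 0)
        - (if i = x then (1:ℝ) else 0) * (if j = q then (1:ℝ) else 0)))
        = c / 4 * (A p j * (if i = q then 1 else 0) - A p i * (if j = q then 1 else 0)) := by
      simp only [mul_sub, Finset.sum_sub_distrib]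
      congr 1
      · rw [Finset.sum_eq_single j] <;> grind
      · rw [Finset.sum_eq_single i] <;> grind
    have hr : ∑ x, c / 4 * ((if i = x then (1:ℝ) else 0) * (if j = p then (1:ℝ) else 0)
        - (if i = p then (1:ℝ) else 0) * (if j = x then (1:ℝ) else 0)) * A x q
        = c / 4 * ((if j = p then 1 else 0) * A i q - (if i = p then 1 else 0) * A j q) := by
      simp only [mul_sub, sub_mul, Finset.sum_sub_distrib]
      congr 1
      · rw [Finset.sum_eq_single i] <;> grind
      · rw [Finset.sum_eq_single j] <;> grind
    rw [hl, hr] at hpq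
    exact mul_left_cancel₀ (by positivity) hpq
  have hoff (i j : Fin n) (hij : i ≠ j) : A i j = 0 := by
    have hij' := hentry i j i i
    have hsymm := hAsymm.apply i j
    simp only [hij.symm, if_true, if_false] at hij'
    linarith
  have hdiag (i j : Fin n) : A j j = A i i := by
    have hji := hentry i j j i
    by_cases hij : i = j
    · rw [hij]
    · simpa [hij, Ne.symm hij] using hji
  refine ⟨A ⟨0, by lia⟩ ⟨0, by lia⟩, ?_⟩
  ext i j
  by_cases hij : i = j
  · subst hij
    simpa using hdiag _ i
  · simp [hij, hoff i j hij]
end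

section
/- Let n ≥ 2 and let c ∈ ℝ with c ≠ 0. Let H1, H2, G be real symmetric n×n matrices and let a, b, μ be real numbers such that: (i) a • H1 + b • G = μ • (identity matrix); (ii) G commutes with H2 (G * H2 = H2 * G); and (iii) for all i, j in Fin n, the (i,j)-entry of the commutator H1 * H2 − H2 * H1 equals (c/4)·(δ 0 j · δ 1 i − δ 0 i · δ 1 j), where 0 and 1 denote the first two indices of Fin n and δ is the Kronecker delta. Then a = 0. -/
open Matrix BigOperators

/-- Algebraic core of the converse direction of Proposition 3.1:
if `a • H1 + b • G` is a multiple of the identity, `G` commutes with `H2`, and the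
commutator of `H1` and `H2` has entries `(c/4)·(δ 0 j · δ 1 i − δ 0 i · δ 1 j)` with
`c ≠ 0`, then `a = 0`. -/
theorem umbilical_normal_component_vanishes
    (n : ℕ) (hn : 2 ≤ n) (c : ℝ) (hc : c ≠ 0)
    (H1 H2 G : Matrix (Fin n) (Fin n) ℝ)
    (hH1 : H1.IsSymm) (hH2 : H2.IsSymm) (hG : G.IsSymm)
    (a b μ : ℝ)
    (humb : a • H1 + b • G = μ • (1 : Matrix (Fin n) (Fin n) ℝ))
    (hcomm : G * H2 = H2 * G)
    (hRicci : ∀ i j : Fin n,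
      (H1 * H2 - H2 * H1) i j
        = (c / 4) * ((if (⟨0, by omega⟩ : Fin n) = j then (1:ℝ) else 0)
              * (if (⟨1, by omega⟩ : Fin n) = i then (1:ℝ) else 0)
            - (if (⟨0, by omega⟩ : Fin n) = i then (1:ℝ) else 0)
              * (if (⟨1, by omega⟩ : Fin n) = j then (1:ℝ) else 0))) :
    a = 0 := by
  have hsmul : a • H1 = μ • (1 : Matrix (Fin n) (Fin n) ℝ) - b • G := eq_sub_of_add_eq humb
  have hzero : a • (H1 * H2 - H2 * H1) = 0 := by
    rw [smul_sub, ← smul_mul_assoc, ← mul_smul_comm, hsmul]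
    simp [sub_mul, mul_sub, hcomm]
  have hentry := congrFun₂ hzero ⟨1, by omega⟩ ⟨0, by omega⟩
  rw [Matrix.smul_apply, hRicci] at hentry
  simpa [hc] using hentry
end

section
/- Let n ≥ 1, c ∈ ℝ, and let h : Fin n → Fin n → Fin n → ℝ be a totally symmetric 3-tensor satisfying the flat Ricci commutator relation with constant c, with slice matrices H m. Then ∑_m (trace (H m))² − ∑_m ‖H m‖² = −(c/4)·n·(n−1), where ‖A‖² = ∑_{i,j} (A i j)² denotes the squared Frobenius norm. -/
open Matrix BigOperators

/-- For a totally symmetric 3-tensor satisfying the flat Ricci commutator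
relation with constant `c`, the traces and Frobenius norms of the slices satisfy
`∑ (trace (H m))² − ∑ ‖H m‖² = −(c/4)·n·(n−1)`. -/
theorem trace_identity_of_flat_ricci
    (n : ℕ) (hn : 1 ≤ n) (c : ℝ)
    (h : Fin n → Fin n → Fin n → ℝ)
    (hsymm12 : ∀ i j k : Fin n, h i j k = h j i k)
    (hsymm23 : ∀ i j k : Fin n, h i j k = h i k j)
    (H : Fin n → Matrix (Fin n) (Fin n) ℝ)
    (hH : ∀ m j k : Fin n, H m j k = h m j k)
    (hRicci : ∀ i j k l : Fin n,
      (H i * H j - H j * H i) k l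
        = (c / 4) * ((if i = l then (1:ℝ) else 0) * (if j = k then (1:ℝ) else 0)
            - (if i = k then (1:ℝ) else 0) * (if j = l then (1:ℝ) else 0))) :
    ∑ m : Fin n, ((H m).trace)^2 - ∑ m : Fin n, ∑ i : Fin n, ∑ j : Fin n, (H m i j)^2
      = -(c / 4) * (n : ℝ) * ((n : ℝ) - 1) := by
  have contraction : ∑ i : Fin n, ∑ j : Fin n, (H i * H j - H j * H i) i j
      = -(c / 4) * (n : ℝ) * ((n : ℝ) - 1) := by
    simp only [hRicci, ← Finset.mul_sum, Finset.sum_sub_distrib]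
    simp [eq_comm]
    ring
  have diagonal_products : ∑ m : Fin n, ((H m).trace)^2
      = ∑ i : Fin n, ∑ j : Fin n, (H i * H j) i j := by
    simp only [Matrix.trace, Matrix.diag_apply, sq, Finset.sum_mul_sum, Matrix.mul_apply]
    rw [Finset.sum_comm]
    refine Finset.sum_congr rfl fun i _ => ?_
    rw [Finset.sum_comm]
    refine Finset.sum_congr rfl fun j _ => Finset.sum_congr rfl fun m _ => ?_
    rw [hH, hH, hH, hH, hsymm12 m i i, hsymm23 i m i, hsymm12 m j j]
  have frobenius_products : ∑ m : Fin n, ∑ i : Fin n, ∑ j : Fin n, (H m i j)^2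
      = ∑ i : Fin n, ∑ j : Fin n, (H j * H i) i j := by
    simp only [Matrix.mul_apply]
    refine Finset.sum_congr rfl fun i _ => Finset.sum_congr rfl fun j _ =>
      Finset.sum_congr rfl fun m _ => ?_
    rw [hH, hH, hH, hsymm12 j i m, hsymm23 i m j, sq]
  rw [diagonal_products, frobenius_products, ← contraction]
  simp only [Matrix.sub_apply, Finset.sum_sub_distrib]
end

section
/- Let n ≥ 1, c ∈ ℝ, and let h : Fin n → Fin n → Fin n → ℝ be a totally symmetric 3-tensor satisfying the flat Ricci commutator relation with constant c, whose every slice H m is traceless (trace (H m) = 0 for all m). Then ∑_m ‖H m‖² = (c/4)·n·(n−1), where ‖A‖² = ∑_{i,j} (A i j)² denotes the squared Frobenius norm. -/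
open Matrix BigOperators

/-- For a totally symmetric 3-tensor satisfying the flat Ricci commutator
relation with constant `c`, if every slice is traceless then
`∑ ‖H m‖² = (c/4)·n·(n−1)`. -/
theorem norm_identity_of_flat_ricci_traceless
    (n : ℕ) (hn : 1 ≤ n) (c : ℝ)
    (h : Fin n → Fin n → Fin n → ℝ)
    (hsymm12 : ∀ i j k : Fin n, h i j k = h j i k)
    (hsymm23 : ∀ i j k : Fin n, h i j k = h i k j)
    (H : Fin n → Matrix (Fin n) (Fin n) ℝ)
    (hH : ∀ m j k : Fin n, H m j k = h m j k)
    (hRicci : ∀ i j k l : Fin n,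
      (H i * H j - H j * H i) k l
        = (c / 4) * ((if i = l then (1:ℝ) else 0) * (if j = k then (1:ℝ) else 0)
            - (if i = k then (1:ℝ) else 0) * (if j = l then (1:ℝ) else 0)))
    (htraceless : ∀ m : Fin n, (H m).trace = 0) :
    ∑ m : Fin n, ∑ i : Fin n, ∑ j : Fin n, (H m i j)^2
      = (c / 4) * (n : ℝ) * ((n : ℝ) - 1) := by
  have h_trace : ∀ m : Fin n, ∑ i, h m i i = 0 := fun m => by
    simpa [Matrix.trace, hH] using htraceless m
  have h_sq : ∑ i, ∑ j, (H i * H j) j i = ∑ m, ∑ i, ∑ j, (H m i j) ^ 2 := by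
    refine Finset.sum_congr rfl fun i _ => Finset.sum_congr rfl fun j _ => ?_
    rw [Matrix.mul_apply]
    refine Finset.sum_congr rfl fun a _ => ?_
    rw [hH, hH, hsymm23 j a i, hsymm12 j i a, sq]
  have h_zero : ∑ i, ∑ j, (H j * H i) j i = 0 := by
    have h_entry : ∀ i j : Fin n, (H j * H i) j i = ∑ a, h a j j * h a i i := fun i j => by
      rw [Matrix.mul_apply]
      refine Finset.sum_congr rfl fun a _ => ?_
      rw [hH, hH, hsymm23 j j a, hsymm12 j a j, hsymm12 i a i]
    refine Finset.sum_eq_zero fun i _ => ?_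
    simp_rw [h_entry]
    rw [Finset.sum_comm]
    simp [← Finset.sum_mul, h_trace]
  have h_sum : ∑ i, ∑ j, (H i * H j - H j * H i) j i = (c / 4) * (n : ℝ) * ((n : ℝ) - 1) := by
    simp_rw [hRicci, ← Finset.mul_sum]
    simp [Finset.sum_sub_distrib]
    ring
  simp only [Matrix.sub_apply, Finset.sum_sub_distrib, h_sq, h_zero, sub_zero] at h_sum
  exact h_sum
end

section
/- Let n ≥ 1, let H ∈ ℝ, let ι be a finite index type, and let B : ι → (real symmetric n×n matrices) be a family of symmetric matrices. Define the 4-tensor R by R m i j k = H²·(δ m j · δ i k − δ m k · δ i j) for indices in Fin n, and set S = ∑_α ∑_{i,j} (B α i j)². Then ∑_α ∑_{i,j,k,m} B α i j · (B α i m · R m k j k + B α k m · R m i j k) = n·H²·S − H²·∑_α (trace (B α))², where all sums over matrix indices range over Fin n. -/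
open Matrix BigOperators

/-- Evaluation of the curvature term III for the constant-curvature
tensor `R m i j k = H²·(δ m j · δ i k − δ m k · δ i j)`:
`III = n·H²·S − H²·∑_α (trace (B α))²`. -/
theorem curvature_term_general
    (n : ℕ) (hn : 1 ≤ n) (H : ℝ)
    (ι : Type*) [Fintype ι]
    (B : ι → Matrix (Fin n) (Fin n) ℝ)
    (hBsymm : ∀ α : ι, (B α).IsSymm)
    (R : Fin n → Fin n → Fin n → Fin n → ℝ)
    (hR : ∀ m i j k : Fin n,
      R m i j k = H^2 * ((if m = j then (1:ℝ) else 0) * (if i = k then (1:ℝ) else 0)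
        - (if m = k then (1:ℝ) else 0) * (if i = j then (1:ℝ) else 0)))
    (S : ℝ)
    (hS : S = ∑ α : ι, ∑ i : Fin n, ∑ j : Fin n, (B α i j)^2) :
    ∑ α : ι, ∑ i : Fin n, ∑ j : Fin n, ∑ k : Fin n, ∑ m : Fin n,
        B α i j * (B α i m * R m k j k + B α k m * R m i j k)
      = (n : ℝ) * H^2 * S - H^2 * ∑ α : ι, ((B α).trace)^2 := by
  have sum_km (A : Matrix (Fin n) (Fin n) ℝ) (i j : Fin n) :
      ∑ k, ∑ m, A i j * (A i m * R m k j k + A k m * R m i j k)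
        = n * H ^ 2 * A i j ^ 2 - H ^ 2 * (A.trace * if i = j then A i j else 0) := by
    have sum_m (k : Fin n) : ∑ m, A i j * (A i m * R m k j k + A k m * R m i j k)
        = H ^ 2 * A i j ^ 2 - (if k = j then H ^ 2 * (A i j * A i k) else 0)
          + (if i = k then H ^ 2 * (A i j * A k j) else 0)
          - H ^ 2 * (A k k * if i = j then A i j else 0) := by
      have expand (m : Fin n) : A i j * (A i m * R m k j k + A k m * R m i j k)
          = (if m = j then H ^ 2 * (A i j * A i m) else 0)
            - (if m = k then (if k = j then H ^ 2 * (A i j * A i m) else 0) else 0)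
            + (if m = j then (if i = k then H ^ 2 * (A i j * A k m) else 0) else 0)
            - (if m = k then H ^ 2 * (A k m * if i = j then A i j else 0) else 0) := by
        simp only [hR, if_true]
        split_ifs <;> ring
      simp only [expand, Finset.sum_add_distrib, Finset.sum_sub_distrib,
        Finset.sum_ite_eq', Finset.mem_univ, if_true]
      ring
    simp only [sum_m, Finset.sum_add_distrib, Finset.sum_sub_distrib, Finset.sum_ite_eq,
      Finset.sum_ite_eq', Finset.mem_univ, if_true, Finset.sum_const, Finset.card_univ,
      Fintype.card_fin, nsmul_eq_mul, ← Finset.mul_sum, ← Finset.sum_mul, Matrix.trace,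
      Matrix.diag_apply]
    ring
  simp only [sum_km]
  simp only [hS, Finset.sum_sub_distrib, ← Finset.mul_sum, Finset.sum_ite_eq,
    Finset.mem_univ, if_true]
  simp only [Matrix.trace, Matrix.diag_apply, sq]
end

section
/- Let n ≥ 1, let H ∈ ℝ, let ι be a finite index type with a distinguished element α₀, and let B : ι → (real symmetric n×n matrices) be a family of symmetric matrices such that B α₀ = H • (identity matrix) and trace (B α) = 0 for every α ≠ α₀. Define the 4-tensor R by R m i j k = H²·(δ m j · δ i k − δ m k · δ i j) for indices in Fin n, and set S = ∑_α ∑_{i,j} (B α i j)². Then ∑_α ∑_{i,j,k,m} B α i j · (B α i m · R m k j k + B α k m · R m i j k) = n·H²·(S − n·H²), where all sums over matrix indices range over Fin n. -/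
open Matrix BigOperators

/-- Contracting a matrix twice with the curvature tensor of constant curvature `c` gives
`c * (n * ‖A‖² - (tr A)²)`, with `‖A‖` the Frobenius norm. -/
theorem sum_mul_constCurvature_eq {n : ℕ} (c : ℝ) (A : Matrix (Fin n) (Fin n) ℝ)
    (R : Fin n → Fin n → Fin n → Fin n → ℝ)
    (hR : ∀ m i j k : Fin n,
      R m i j k = c * ((if m = j then (1:ℝ) else 0) * (if i = k then (1:ℝ) else 0)
        - (if m = k then (1:ℝ) else 0) * (if i = j then (1:ℝ) else 0))) :
    ∑ i : Fin n, ∑ j : Fin n, ∑ k : Fin n, ∑ m : Fin n,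
        A i j * (A i m * R m k j k + A k m * R m i j k)
      = c * (n * ∑ i : Fin n, ∑ j : Fin n, (A i j)^2 - A.trace^2) := by
  have ricci (i j : Fin n) :
      ∑ k : Fin n, ∑ m : Fin n, A i m * R m k j k = c * (n - 1) * A i j := by
    simp [hR, mul_sub, Finset.sum_sub_distrib]
    ring
  have mixed (i j : Fin n) :
      ∑ k : Fin n, ∑ m : Fin n, A k m * R m i j k
        = c * (A i j - if i = j then A.trace else 0) := by
    by_cases h : i = j <;>
      simp [hR, h, mul_sub, Finset.sum_sub_distrib, Matrix.trace, Finset.mul_sum, mul_comm]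
  calc
    _ = ∑ i : Fin n, ∑ j : Fin n,
          (c * n * (A i j)^2 - c * A.trace * if i = j then A i j else 0) := by
      refine Finset.sum_congr rfl fun i _ => Finset.sum_congr rfl fun j _ => ?_
      simp only [← Finset.mul_sum, Finset.sum_add_distrib, ricci, mixed]
      split_ifs <;> ring
    _ = _ := by
      have htr : ∑ i : Fin n, A i i = A.trace := rfl
      simp only [Finset.sum_sub_distrib, ← Finset.mul_sum, Finset.sum_ite_eq, Finset.mem_univ,
        if_true, htr]
      ring

/-- Lemma 4.3 of the paper: with `B α₀ = H • 1` and all other slices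
traceless, the curvature term equals `n·H²·(S − n·H²)`. -/
theorem curvature_term_pseudo_umbilical
    (n : ℕ) (hn : 1 ≤ n) (H : ℝ)
    (ι : Type*) [Fintype ι] (α₀ : ι)
    (B : ι → Matrix (Fin n) (Fin n) ℝ)
    (hBsymm : ∀ α : ι, (B α).IsSymm)
    (hB0 : B α₀ = H • (1 : Matrix (Fin n) (Fin n) ℝ))
    (htraceless : ∀ α : ι, α ≠ α₀ → (B α).trace = 0)
    (R : Fin n → Fin n → Fin n → Fin n → ℝ)
    (hR : ∀ m i j k : Fin n,
      R m i j k = H^2 * ((if m = j then (1:ℝ) else 0) * (if i = k then (1:ℝ) else 0)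
        - (if m = k then (1:ℝ) else 0) * (if i = j then (1:ℝ) else 0)))
    (S : ℝ)
    (hS : S = ∑ α : ι, ∑ i : Fin n, ∑ j : Fin n, (B α i j)^2) :
    ∑ α : ι, ∑ i : Fin n, ∑ j : Fin n, ∑ k : Fin n, ∑ m : Fin n,
        B α i j * (B α i m * R m k j k + B α k m * R m i j k)
      = (n : ℝ) * H^2 * (S - (n : ℝ) * H^2) := by
  have htr : ∑ α : ι, (B α).trace^2 = (n * H)^2 := by
    rw [Fintype.sum_eq_single α₀ fun α hα => by simp [htraceless α hα], hB0]
    simp [mul_comm]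
  rw [Finset.sum_congr rfl fun α _ => sum_mul_constCurvature_eq (H^2) (B α) R hR]
  simp only [← Finset.mul_sum, Finset.sum_sub_distrib, htr, ← hS]
  ring
end
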